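/- If M is a sober MT-algebra such that O(M) is a continuous frame, then M is locally compact. -/

import Mathlib

/-- An MT-algebra: a complete Boolean algebra with an interior operator. -/
structure MTAlg (M : Type*) [CompleteBooleanAlgebra M] where
  box : M → M
  box_top : box ⊤ = ⊤
  box_inf : ∀ a b : M, box (a ⊓ b) = box a ⊓ box b
  box_le : ∀ a : M, box a ≤ a
  box_idem : ∀ a : M, box a ≤ box (box a)

namespace MTAlg

variable {M : Type*} [CompleteBooleanAlgebra M] (T : MTAlg M)

/-- The closure (dual) operator. -/
def dia (a : M) : M := (T.box aᶜ)ᶜ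

/-- Open elements. -/
def IsOpenElem (a : M) : Prop := T.box a = a

/-- Closed elements. -/
def IsClosedElem (a : M) : Prop := T.dia a = a

/-- Saturated elements: meets of open elements. -/
def IsSaturatedElem (a : M) : Prop :=
  ∃ S : Set M, (∀ s ∈ S, T.IsOpenElem s) ∧ a = sInf S

/-- Weakly locally closed elements: meets of a saturated and a closed element. -/
def IsWLC (a : M) : Prop :=
  ∃ s c : M, T.IsSaturatedElem s ∧ T.IsClosedElem c ∧ a = s ⊓ c

/-- T0-algebras: every element is a join of weakly locally closed elements. -/
def IsT0 : Prop :=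
  ∀ a : M, ∃ S : Set M, (∀ b ∈ S, T.IsWLC b) ∧ a = sSup S

/-- T1-algebras: every element is a join of closed elements. -/
def IsT1 : Prop :=
  ∀ a : M, ∃ S : Set M, (∀ b ∈ S, T.IsClosedElem b) ∧ a = sSup S

/-- Join-irreducible elements of the lattice of closed elements. -/
def JoinIrredClosed (p : M) : Prop :=
  T.IsClosedElem p ∧ p ≠ ⊥ ∧
    ∀ a b : M, T.IsClosedElem a → T.IsClosedElem b → p = a ⊔ b → p = a ∨ p = b

/-- Sober MT-algebras. -/
def Sober : Prop :=
  T.IsT0 ∧ ∀ p : M, T.JoinIrredClosed p → ∃ x : M, IsAtom x ∧ p = T.dia x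

/-- Filters of the underlying lattice. -/
def IsFilter (F : Set M) : Prop :=
  ⊤ ∈ F ∧ (∀ a b : M, a ∈ F → a ≤ b → b ∈ F) ∧ (∀ a b : M, a ∈ F → b ∈ F → a ⊓ b ∈ F)

/-- Open filters. -/
def IsOpenFilter (F : Set M) : Prop :=
  IsFilter F ∧ ∀ a ∈ F, T.box a ∈ F

/-- Scott-open filters. -/
def IsScottOpenFilter (F : Set M) : Prop :=
  T.IsOpenFilter F ∧
    ∀ S : Set M, (∀ s ∈ S, T.IsOpenElem s) → S.Nonempty → DirectedOn (· ≤ ·) S →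
      sSup S ∈ F → ∃ s ∈ S, s ∈ F

/-- Compact elements. -/
def IsCompactElem (a : M) : Prop :=
  ∀ S : Set M, (∀ s ∈ S, T.IsOpenElem s) → a ≤ sSup S →
    ∃ t ⊆ S, t.Finite ∧ a ≤ sSup t

/-- The relation `a ◁ b`: there is a compact element between `a` and `b`. -/
def Triangle (a b : M) : Prop := ∃ k : M, T.IsCompactElem k ∧ a ≤ k ∧ k ≤ b

/-- Locally compact MT-algebras. -/
def LocallyCompact : Prop :=
  ∀ u : M, T.IsOpenElem u → u = sSup {v : M | T.IsOpenElem v ∧ T.Triangle v u}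

/-- The way-below relation in the frame of open elements. -/
def WayBelowOpen (a b : M) : Prop :=
  ∀ S : Set M, (∀ s ∈ S, T.IsOpenElem s) → b ≤ sSup S →
    ∃ t ⊆ S, t.Finite ∧ a ≤ sSup t

/-- Elements approximated from above by regular closed elements. -/
def GC (a : M) : Prop :=
  a = sInf {b : M | ∃ c : M, a ≤ T.box c ∧ b = T.dia (T.box c)}

/-- Hausdorff MT-algebras. -/
def IsHausdorff : Prop :=
  ∀ a : M, ∃ S : Set M, (∀ b ∈ S, T.GC b) ∧ a = sSup S

/-- Regular MT-algebras. -/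
def IsRegular : Prop :=
  T.IsT1 ∧ ∀ a : M, T.IsOpenElem a →
    a = sSup {b : M | T.IsOpenElem b ∧ T.dia b ≤ a}

end MTAlg

/-- The atom space of a complete Boolean algebra. -/
abbrev AtomSpace (M : Type*) [CompleteBooleanAlgebra M] : Type _ := {x : M // IsAtom x}

/-- The set of atoms below an element. -/
def eta {M : Type*} [CompleteBooleanAlgebra M] (a : M) : Set (AtomSpace M) :=
  {x : AtomSpace M | x.1 ≤ a}

namespace MTAlg

variable {M : Type*} [CompleteBooleanAlgebra M] (T : MTAlg M)

/-- The topology on the atom space, generated by the images of open elements. -/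
def atTop : TopologicalSpace (AtomSpace M) :=
  TopologicalSpace.generateFrom {U : Set (AtomSpace M) | ∃ u : M, T.IsOpenElem u ∧ U = eta u}

end MTAlg

namespace MTAlg

section

variable {M : Type*} [CompleteBooleanAlgebra M] {T : MTAlg M}

theorem box_mono {a b : M} (h : a ≤ b) : T.box a ≤ T.box b := by
  rw [← inf_eq_left.mpr h, T.box_inf]
  exact inf_le_right

theorem isOpenElem_sSup {S : Set M} (hS : ∀ s ∈ S, T.IsOpenElem s) : T.IsOpenElem (sSup S) :=
  le_antisymm (T.box_le _) <| sSup_le fun s hs => by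
    have h := hS s hs
    rw [← h]
    exact box_mono (le_sSup hs)

theorem IsOpenElem.sup {a b : M} (ha : T.IsOpenElem a) (hb : T.IsOpenElem b) :
    T.IsOpenElem (a ⊔ b) := by
  rw [← sSup_pair]
  exact isOpenElem_sSup (by rintro s (rfl | rfl) <;> assumption)

theorem isClosedElem_compl_iff {a : M} : T.IsClosedElem aᶜ ↔ T.IsOpenElem a := by
  simp only [IsClosedElem, IsOpenElem, dia, compl_compl, compl_inj_iff]

theorem IsClosedElem.compl {a : M} (ha : T.IsClosedElem a) : T.IsOpenElem aᶜ :=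
  isClosedElem_compl_iff.mp (by rwa [compl_compl])

theorem WayBelowOpen.le {a b : M} (h : T.WayBelowOpen a b) (hb : T.IsOpenElem b) : a ≤ b := by
  obtain ⟨t, ht, -, hat⟩ := h {b} (by rintro s rfl; exact hb) (by simp)
  exact hat.trans (sSup_le fun s hs => (ht hs).le)

theorem WayBelowOpen.mono {a a' b b' : M} (h : T.WayBelowOpen a b) (ha : a' ≤ a) (hb : b ≤ b') :
    T.WayBelowOpen a' b' := fun S hS hbS => by
  obtain ⟨t, ht, htf, hat⟩ := h S hS (hb.trans hbS)
  exact ⟨t, ht, htf, ha.trans hat⟩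

theorem WayBelowOpen.sup {a a' b : M} (h : T.WayBelowOpen a b) (h' : T.WayBelowOpen a' b) :
    T.WayBelowOpen (a ⊔ a') b := fun S hS hbS => by
  obtain ⟨t, ht, htf, hat⟩ := h S hS hbS
  obtain ⟨t', ht', htf', hat'⟩ := h' S hS hbS
  refine ⟨t ∪ t', Set.union_subset ht ht', htf.union htf', ?_⟩
  rw [sSup_union]
  exact sup_le_sup hat hat'

theorem wayBelowOpen_bot (b : M) : T.WayBelowOpen ⊥ b := fun _ _ _ =>
  ⟨∅, Set.empty_subset _, Set.finite_empty, bot_le⟩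

/-- A finite join of opens, each interpolating below `b`, interpolates below `b`. -/
theorem exists_wayBelowOpen_of_finite {b : M} {t : Set M} (htf : t.Finite)
    (ht : ∀ z ∈ t, ∃ y, T.IsOpenElem y ∧ T.WayBelowOpen z y ∧ T.WayBelowOpen y b) :
    ∃ w, T.IsOpenElem w ∧ T.WayBelowOpen (sSup t) w ∧ T.WayBelowOpen w b := by
  induction t, htf using Set.Finite.induction_on with
  | empty =>
    refine ⟨⊥, le_antisymm (T.box_le _) bot_le, ?_, wayBelowOpen_bot b⟩
    rw [sSup_empty]
    exact wayBelowOpen_bot _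
  | insert _ _ ih =>
    obtain ⟨w, hw, htw, hwb⟩ := ih fun z hz => ht z (Set.mem_insert_of_mem _ hz)
    obtain ⟨y, hy, hzy, hyb⟩ := ht _ (Set.mem_insert _ _)
    refine ⟨y ⊔ w, hy.sup hw, ?_, hyb.sup hwb⟩
    rw [sSup_insert]
    exact (hzy.mono le_rfl le_sup_left).sup (htw.mono le_rfl le_sup_right)

/-- The way-below relation of a continuous frame of opens interpolates. -/
theorem WayBelowOpen.interpolate
    (hcont : ∀ a : M, T.IsOpenElem a →
      a = sSup {v : M | T.IsOpenElem v ∧ T.WayBelowOpen v a})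
    {v b : M} (hb : T.IsOpenElem b) (h : T.WayBelowOpen v b) :
    ∃ w, T.IsOpenElem w ∧ T.WayBelowOpen v w ∧ T.WayBelowOpen w b := by
  obtain ⟨t, ht, htf, hvt⟩ := h
    {z | T.IsOpenElem z ∧ ∃ y, T.IsOpenElem y ∧ T.WayBelowOpen z y ∧ T.WayBelowOpen y b}
    (fun s hs => hs.1) (by
      conv_lhs => rw [hcont b hb]
      refine sSup_le fun y hy => ?_
      conv_lhs => rw [hcont y hy.1]
      exact sSup_le fun z hz => le_sSup ⟨hz.1, y, hy.1, hz.2, hy.2⟩)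
  obtain ⟨w, hw, htw, hwb⟩ := exists_wayBelowOpen_of_finite htf fun z hz => (ht hz).2
  exact ⟨w, hw, htw.mono hvt le_rfl, hwb⟩

/-- An open element above the meet of a way-below-descending sequence of opens of a sober
MT-algebra is above a member of the sequence. -/
theorem Sober.exists_le_of_iInf_le (hsob : T.Sober) {w : ℕ → M} (hw : ∀ n, T.IsOpenElem (w n))
    (hstep : ∀ n, T.WayBelowOpen (w (n + 1)) (w n)) {a : M} (ha : T.IsOpenElem a)
    (hwa : ⨅ n, w n ≤ a) : ∃ n, w n ≤ a := by
  by_contra hna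
  have hanti : Antitone w := antitone_nat_of_succ_le fun n => (hstep n).le (hw n)
  obtain ⟨m, ham, hm⟩ := zorn_le_nonempty₀ {x | T.IsOpenElem x ∧ ¬∃ n, w n ≤ x} (by
    intro c hc hchain y hy
    refine ⟨sSup c, ⟨isOpenElem_sSup fun s hs => (hc hs).1, ?_⟩, fun z hz => le_sSup hz⟩
    rintro ⟨n, hn⟩
    obtain ⟨t, htc, htf, hwt⟩ := hstep n c (fun s hs => (hc hs).1) hn
    obtain ⟨z, hz, htz⟩ : ∃ z ∈ c, ∀ s ∈ t, s ≤ z := by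
      clear hwt
      induction t, htf using Set.Finite.induction_on with
      | empty => exact ⟨y, hy, by simp⟩
      | insert _ _ ih =>
        obtain ⟨z, hz, htz⟩ := ih ((Set.subset_insert _ _).trans htc)
        obtain ⟨z', hz', h₁, h₂⟩ := hchain.directedOn _ (htc (Set.mem_insert _ _)) z hz
        refine ⟨z', hz', ?_⟩
        rintro s (rfl | hs)
        exacts [h₁, (htz s hs).trans h₂]
    exact (hc hz).2 ⟨n + 1, hwt.trans (sSup_le htz)⟩) a ⟨ha, hna⟩
  have hgt : ∀ x, T.IsOpenElem x → m ≤ x → x ≠ m → ∃ n, w n ≤ x := by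
    intro x hx hmx hne
    by_contra hn
    exact hne (le_antisymm (hm.2 ⟨hx, hn⟩ hmx) hmx)
  have hirr : T.JoinIrredClosed mᶜ := by
    refine ⟨isClosedElem_compl_iff.mpr hm.1.1, ?_, ?_⟩
    · intro h
      exact hm.1.2 ⟨0, by rw [compl_eq_bot.mp h]; exact le_top⟩
    · intro p q hp hq hpq
      by_contra! hne
      have hm' : m = pᶜ ⊓ qᶜ := by rw [← compl_sup, ← hpq, compl_compl]
      obtain ⟨i, hi⟩ := hgt pᶜ hp.compl (hm' ▸ inf_le_left)
        fun h => hne.1 (by rw [← h, compl_compl])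
      obtain ⟨j, hj⟩ := hgt qᶜ hq.compl (hm' ▸ inf_le_right)
        fun h => hne.2 (by rw [← h, compl_compl])
      refine hm.1.2 ⟨max i j, ?_⟩
      rw [hm']
      exact le_inf ((hanti (le_max_left i j)).trans hi) ((hanti (le_max_right i j)).trans hj)
  obtain ⟨x, hx, hmx⟩ := hsob.2 _ hirr
  have hbox : m = T.box xᶜ := compl_injective hmx
  have hxm : x ≤ m := by
    refine (le_iInf fun n => ?_).trans (hwa.trans ham)
    by_contra hxn
    refine hm.1.2 ⟨n, ?_⟩
    rw [hbox, ← hw n]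
    exact box_mono (le_compl_iff_disjoint_left.mpr (hx.not_le_iff_disjoint.mp hxn))
  exact hx.1 (disjoint_self.mp (le_compl_iff_disjoint_right.mp
    (hxm.trans (hbox.le.trans (T.box_le _)))))

theorem Sober.isCompactElem_iInf (hsob : T.Sober) {w : ℕ → M} (hw : ∀ n, T.IsOpenElem (w n))
    (hstep : ∀ n, T.WayBelowOpen (w (n + 1)) (w n)) : T.IsCompactElem (⨅ n, w n) := by
  intro S hS hwS
  obtain ⟨n, hn⟩ := hsob.exists_le_of_iInf_le hw hstep (isOpenElem_sSup hS) hwS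
  obtain ⟨t, ht, htf, hwt⟩ := hstep n S hS hn
  exact ⟨t, ht, htf, (iInf_le w (n + 1)).trans hwt⟩

theorem Sober.triangle_of_wayBelowOpen (hsob : T.Sober)
    (hcont : ∀ a : M, T.IsOpenElem a →
      a = sSup {v : M | T.IsOpenElem v ∧ T.WayBelowOpen v a})
    {v u : M} (hu : T.IsOpenElem u) (h : T.WayBelowOpen v u) : T.Triangle v u := by
  choose! f hf using fun b (hb : T.IsOpenElem b ∧ T.WayBelowOpen v b) =>
    hb.2.interpolate hcont hb.1
  have key : ∀ n, T.IsOpenElem (f^[n] u) ∧ T.WayBelowOpen v (f^[n] u) := by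
    intro n
    induction n with
    | zero => exact ⟨hu, h⟩
    | succ n ih =>
      rw [Function.iterate_succ_apply']
      exact ⟨(hf _ ih).1, (hf _ ih).2.1⟩
  refine ⟨⨅ n, f^[n] u, hsob.isCompactElem_iInf (fun n => (key n).1) fun n => ?_,
    le_iInf fun n => (key n).2.le (key n).1, iInf_le (fun n => f^[n] u) 0⟩
  rw [Function.iterate_succ_apply']
  exact (hf _ (key n)).2.2

end

end MTAlg

/-- If `M` is a sober MT-algebra whose frame of opens is continuous,
then `M` is locally compact. -/
theorem locallyCompact_of_sober_continuous {M : Type*} [CompleteBooleanAlgebra M]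
    (T : MTAlg M) (hsob : T.Sober)
    (hcont : ∀ a : M, T.IsOpenElem a →
      a = sSup {v : M | T.IsOpenElem v ∧ T.WayBelowOpen v a}) :
    T.LocallyCompact := by
  intro u hu
  refine le_antisymm ?_ (sSup_le fun v ⟨_, k, _, hvk, hku⟩ => hvk.trans hku)
  conv_lhs => rw [hcont u hu]
  exact sSup_le_sSup fun v hv => ⟨hv.1, hsob.triangle_of_wayBelowOpen hcont hu hv.2⟩
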